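/- Let U be a connected open subset of a separable complex Banach space X and (f_n) a sequence of holomorphic functions U → ℂ that is uniformly bounded on every compact subset of U. Suppose there exists a nonempty open set V ⊆ U such that (f_n(x)) converges for every x ∈ V. Then (f_n) converges uniformly on every compact subset of U, and the limit is holomorphic on U. -/

import Mathlib

open Set Metric Filter

section helpers

variable {X : Type*} [NormedAddCommGroup X] [NormedSpace ℂ X]

lemma mm_mapsTo {f : X → ℂ} {c : X} {r M : ℝ} (hr : 0 < r)
    (hM : ∀ z ∈ ball c r, ‖f z‖ ≤ M) :
    MapsTo f (ball c r) (closedBall (f c) (2 * M)) := by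
  intro z hz
  rw [mem_closedBall, dist_eq_norm]
  have h1 := hM z hz
  have h2 := hM c (mem_ball_self hr)
  have h3 := norm_sub_le (f z) (f c)
  linarith

lemma mm_fderiv {f : X → ℂ} {c : X} {r M : ℝ} (hr : 0 < r)
    (hd : DifferentiableOn ℂ f (ball c r)) (hM : ∀ z ∈ ball c r, ‖f z‖ ≤ M) :
    ‖fderiv ℂ f c‖ ≤ 2 * M / r :=
  Complex.norm_fderiv_le_div_of_mapsTo_ball hd (mm_mapsTo hr hM) hr

lemma mm_second {f : X → ℂ} {c z : X} {r M : ℝ} (hr : 0 < r)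
    (hd : DifferentiableOn ℂ f (ball c r)) (hM : ∀ z ∈ ball c r, ‖f z‖ ≤ M)
    (hz : z ∈ ball c r) :
    ‖f z - f c - fderiv ℂ f c (z - c)‖ ≤ 4 * M * (dist z c / r) ^ 2 := by
  have hA := mm_fderiv hr hd hM
  set A := fderiv ℂ f c with hAdef
  have hfA : HasFDerivAt f A c := (hd.differentiableAt (ball_mem_nhds c hr)).hasFDerivAt
  let h : X → ℂ := fun w => f w - A (w - c)
  have hhd : DifferentiableOn ℂ h (ball c r) := hd.sub (by fun_prop)
  have hhc : h c = f c := by simp [h]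
  have hmaps : MapsTo h (ball c r) (closedBall (h c) (4 * M)) := by
    intro w hw
    rw [mem_closedBall, dist_eq_norm, hhc]
    have h1 := mm_mapsTo hr hM hw
    rw [mem_closedBall, dist_eq_norm] at h1
    have h2 : ‖A (w - c)‖ ≤ 2 * M / r * r := by
      refine (A.le_opNorm _).trans ?_
      rw [mem_ball, dist_eq_norm] at hw
      have := (norm_nonneg A).trans hA
      gcongr
    rw [div_mul_cancel₀ _ hr.ne'] at h2
    have h3 : h w - f c = (f w - f c) - A (w - c) := by simp only [h]; ring
    rw [h3]
    have := norm_sub_le (f w - f c) (A (w - c))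
    linarith
  have hn : (h · - h c) =o[nhds c] (fun w ↦ ‖w - c‖ ^ 1) := by
    have := hfA.isLittleO
    simp only [pow_one]
    refine (this.norm_right).congr_left ?_
    intro w
    rw [hhc]; simp only [h]; ring
  have := Complex.dist_le_mul_div_pow_of_mapsTo_ball_of_isLittleO hhd hmaps hn hz
  rw [dist_eq_norm, hhc] at this
  have e : h z - f c = f z - f c - A (z - c) := by simp only [h]; ring
  rwa [e] at this

lemma mm_limit {f : ℕ → X → ℂ} {g : X → ℂ} {c : X} {r M : ℝ} (hr : 0 < r)
    (u : Ultrafilter ℕ)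
    (hd : ∀ n, DifferentiableOn ℂ (f n) (ball c r)) (hM : ∀ n, ∀ z ∈ ball c r, ‖f n z‖ ≤ M)
    (hg : ∀ z ∈ ball c r, Tendsto (fun n => f n z) u (nhds (g z))) :
    DifferentiableAt ℂ g c := by
  have hcomp := WeakDual.isCompact_closedBall (𝕜 := ℂ) (E := X) 0 (2 * M / r)
  obtain ⟨A, -, hA⟩ := hcomp.ultrafilter_le_nhds
    (u.map (fun n => StrongDual.toWeakDual (fderiv ℂ (f n) c))) (by
      rw [le_principal_iff, Ultrafilter.coe_map, mem_map]
      refine univ_mem' fun n => ?_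
      simpa using mm_fderiv hr (hd n) (hM n))
  have hA' : ∀ v, Tendsto (fun n => fderiv ℂ (f n) c v) u (nhds (A v)) := by
    intro v
    exact ((WeakDual.eval_continuous (𝕜 := ℂ) v).tendsto A).comp hA
  have key : ∀ z ∈ ball c r, ‖g z - g c - A (z - c)‖ ≤ 4 * M * (dist z c / r) ^ 2 := by
    intro z hz
    refine le_of_tendsto (((hg z hz).sub (hg c (mem_ball_self hr))).sub (hA' (z - c))).norm ?_
    exact Eventually.of_forall fun n => mm_second hr (hd n) (hM n) hz
  have : HasFDerivAt g (WeakDual.toStrongDual A) c := by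
    rw [hasFDerivAt_iff_isLittleO]
    have h1 : (fun z => g z - g c - (WeakDual.toStrongDual A) (z - c)) =O[nhds c]
        fun z => ‖z - c‖ ^ 2 := by
      refine Asymptotics.IsBigO.of_bound (4 * M / r ^ 2) ?_
      filter_upwards [ball_mem_nhds c hr] with z hz
      refine (key z hz).trans_eq ?_
      rw [dist_eq_norm, norm_pow, norm_norm]
      field_simp
    refine h1.trans_isLittleO ?_
    have h2 := Asymptotics.isLittleO_pow_sub_sub c one_lt_two
    exact h2
  exact this.differentiableAt

lemma mm_ident {U : Set X} (hU : IsOpen U) (hUc : IsPreconnected U) {g : X → ℂ}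
    (hg : DifferentiableOn ℂ g U) {V : Set X} (hV : IsOpen V) (hVne : V.Nonempty) (hVU : V ⊆ U)
    (h0 : ∀ x ∈ V, g x = 0) : ∀ x ∈ U, g x = 0 := by
  have hsub : U ⊆ interior {x | g x = 0} := by
    refine hUc.subset_of_closure_inter_subset isOpen_interior ?_ ?_
    · obtain ⟨v, hv⟩ := hVne
      exact ⟨v, hVU hv, (interior_maximal h0 hV) hv⟩
    · rintro x ⟨hx, hxU⟩
      obtain ⟨r, hr, hrU⟩ := Metric.isOpen_iff.1 hU x hxU
      obtain ⟨y, hyW, hy⟩ := Metric.mem_closure_iff.1 hx r hr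
      have hyb : y ∈ ball x r := by rwa [mem_ball, dist_comm]
      rw [mem_interior_iff_mem_nhds]
      filter_upwards [ball_mem_nhds x hr] with z hz
      let l : ℂ → X := fun t => y + t • (z - y)
      have hl : Differentiable ℂ l := by fun_prop
      let S : Set ℂ := l ⁻¹' ball x r
      have hSo : IsOpen S := isOpen_ball.preimage hl.continuous
      have hSc : Convex ℝ S := by
        intro a ha b hb s t hs ht hst
        have := (convex_ball x r) ha hb hs ht hst
        have e : l (s • a + t • b) = s • l a + t • l b := by
          simp only [l]
          have : y = (s + t) • y := by rw [hst, one_smul]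
          nth_rewrite 1 [this]
          simp only [Complex.real_smul]
          module
        change l (s • a + t • b) ∈ ball x r
        rwa [e]
      have hφ : DifferentiableOn ℂ (g ∘ l) S :=
        hg.comp hl.differentiableOn (fun t ht => hrU ht)
      have han : AnalyticOnNhd ℂ (g ∘ l) S := hφ.analyticOnNhd hSo
      have h0S : (0 : ℂ) ∈ S := by simpa [S, l] using hyb
      have h1S : (1 : ℂ) ∈ S := by simpa [S, l] using hz
      have hev : (g ∘ l) =ᶠ[nhds 0] 0 := by
        have : {x | g x = 0} ∈ nhds (l 0) := by
          simpa [l] using mem_interior_iff_mem_nhds.1 hyW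
        exact hl.continuous.continuousAt this
      have := han.eqOn_zero_of_preconnected_of_eventuallyEq_zero hSc.isPreconnected h0S hev h1S
      simpa [l] using this
  intro x hx
  have h : x ∈ {x | g x = 0} := interior_subset (hsub hx)
  exact h

lemma mm_locbd {U : Set X} (hU : IsOpen U) {f : ℕ → X → ℂ}
    (hbd : ∀ L : Set X, L ⊆ U → IsCompact L → ∃ M : ℝ, ∀ n, ∀ z ∈ L, ‖f n z‖ ≤ M)
    {x : X} (hx : x ∈ U) :
    ∃ r > 0, ball x r ⊆ U ∧ ∃ M : ℝ, ∀ n, ∀ z ∈ ball x r, ‖f n z‖ ≤ M := by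
  obtain ⟨r, hr, hrU⟩ := Metric.isOpen_iff.1 hU x hx
  by_contra! hcon
  have : ∀ k : ℕ, ∃ n, ∃ z ∈ ball x (r / (k + 1)), (k : ℝ) < ‖f n z‖ := by
    intro k
    refine hcon (r / (k + 1)) (by positivity) (subset_trans (ball_subset_ball ?_) hrU) k
    exact div_le_self hr.le (by linarith [Nat.cast_nonneg (α := ℝ) k])
  choose n z hz hn using this
  have hlim : Tendsto z atTop (nhds x) := by
    rw [tendsto_iff_dist_tendsto_zero]
    refine squeeze_zero (fun _ => dist_nonneg) (fun k => (mem_ball.1 (hz k)).le) ?_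
    have := tendsto_one_div_add_atTop_nhds_zero_nat (𝕜 := ℝ) |>.const_mul r
    simpa [div_eq_mul_inv] using this
  obtain ⟨M, hM⟩ := hbd _ (by
    rw [insert_subset_iff]
    refine ⟨hx, ?_⟩
    rintro _ ⟨k, rfl⟩
    refine hrU (ball_subset_ball ?_ (hz k))
    exact div_le_self hr.le (by linarith [Nat.cast_nonneg (α := ℝ) k])) hlim.isCompact_insert_range
  obtain ⟨k, hk⟩ := exists_nat_gt M
  have := hM (n k) (z k) (Or.inr ⟨k, rfl⟩)
  linarith [hn k]

end helpers

/-- **Mujica's Montel theorem with pointwise convergence.**  Let `U` be a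
connected open subset of a separable complex Banach space and `(f_n)` a sequence
of holomorphic functions on `U`, uniformly bounded on every compact subset of
`U`, converging pointwise on some nonempty open `V ⊆ U`.  Then `(f_n)` converges
uniformly on every compact subset of `U` to a holomorphic function. -/
theorem mujica_montel_pointwise
    {X : Type*} [NormedAddCommGroup X] [NormedSpace ℂ X] [CompleteSpace X]
    [TopologicalSpace.SeparableSpace X]
    (U : Set X) (hU : IsOpen U) (hUconn : IsConnected U)
    (f : ℕ → X → ℂ) (hol : ∀ n, DifferentiableOn ℂ (f n) U)
    (hbd : ∀ L : Set X, L ⊆ U → IsCompact L → ∃ M : ℝ, ∀ n, ∀ z ∈ L, ‖f n z‖ ≤ M)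
    (V : Set X) (hV : IsOpen V) (hVne : V.Nonempty) (hVU : V ⊆ U)
    (hconv : ∀ x ∈ V, ∃ L : ℂ, Tendsto (fun n => f n x) atTop (nhds L)) :
    ∃ g : X → ℂ, DifferentiableOn ℂ g U ∧
      ∀ K : Set X, K ⊆ U → IsCompact K → TendstoUniformlyOn f g atTop K := by
  have hloc := fun x (hx : x ∈ U) => mm_locbd hU hbd hx
  -- limits along ultrafilters
  have hlimu : ∀ u : Ultrafilter ℕ, ∃ g : X → ℂ, ∀ x ∈ U,
      Tendsto (fun n => f n x) u (nhds (g x)) := by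
    intro u
    have : ∀ x, ∃ y : ℂ, x ∈ U → Tendsto (fun n => f n x) u (nhds y) := by
      intro x
      by_cases hx : x ∈ U
      · obtain ⟨M, hM⟩ := hbd {x} (by simpa using hx) isCompact_singleton
        obtain ⟨y, -, hy⟩ := (isCompact_closedBall (0 : ℂ) M).ultrafilter_le_nhds
          (u.map (fun n => f n x)) (by
            rw [le_principal_iff, Ultrafilter.coe_map, mem_map]
            refine univ_mem' fun n => ?_
            simpa using hM n x rfl)
        exact ⟨y, fun _ => hy⟩
      · exact ⟨0, fun h => absurd h hx⟩
    choose g hg using this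
    exact ⟨g, hg⟩
  choose G hG using hlimu
  have hGd : ∀ u, DifferentiableOn ℂ (G u) U := by
    intro u x hx
    obtain ⟨r, hr, hrU, M, hM⟩ := hloc x hx
    exact (mm_limit hr u (fun n => (hol n).mono hrU) hM
      (fun z hz => hG u z (hrU hz))).differentiableWithinAt
  let u₀ : Ultrafilter ℕ := Ultrafilter.of atTop
  have hu₀ : (u₀ : Filter ℕ) ≤ atTop := Ultrafilter.of_le _
  have hpt : ∀ x ∈ U, Tendsto (fun n => f n x) atTop (nhds (G u₀ x)) := by
    intro x hx
    rw [tendsto_iff_ultrafilter]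
    intro u hu
    have hz : G u x - G u₀ x = 0 := by
      refine mm_ident hU hUconn.isPreconnected (g := fun x => G u x - G u₀ x)
        ((hGd u).sub (hGd u₀)) hV hVne hVU ?_ x hx
      intro v hv
      obtain ⟨L, hL⟩ := hconv v hv
      have h1 := tendsto_nhds_unique (hG u v (hVU hv)) (hL.mono_left hu)
      have h2 := tendsto_nhds_unique (hG u₀ v (hVU hv)) (hL.mono_left hu₀)
      simp [h1, h2]
    rw [← sub_eq_zero.1 hz]
    exact hG u x hx
  refine ⟨G u₀, hGd u₀, fun K hKU hK => ?_⟩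
  rw [← tendstoLocallyUniformlyOn_iff_tendstoUniformlyOn_of_compact hK,
    Metric.tendstoLocallyUniformlyOn_iff]
  intro ε hε x hx
  obtain ⟨r, hr, hrU, M, hM⟩ := hloc x (hKU hx)
  have hlip : ∀ n, ∀ z ∈ ball x r, dist (f n z) (f n x) ≤ 2 * M / r * dist z x := fun n z hz =>
    Complex.dist_le_div_mul_dist_of_mapsTo_ball ((hol n).mono hrU) (mm_mapsTo hr (hM n)) hz
  have hsmall : ∀ᶠ z in nhds x, 2 * M / r * dist z x < ε / 4 := by
    have : Tendsto (fun z => 2 * M / r * dist z x) (nhds x) (nhds (2 * M / r * dist x x)) :=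
      Continuous.tendsto (by fun_prop) x
    rw [dist_self, mul_zero] at this
    exact this.eventually_lt_const (by positivity)
  refine ⟨{z | z ∈ ball x r ∧ 2 * M / r * dist z x < ε / 4},
    mem_nhdsWithin_of_mem_nhds (Filter.inter_mem (ball_mem_nhds x hr) hsmall), ?_⟩
  filter_upwards [Metric.tendsto_nhds.1 (hpt x (hKU hx)) (ε / 4) (by positivity)] with n hn
  rintro z ⟨hz, hzs⟩
  have h1 : dist (G u₀ z) (G u₀ x) ≤ 2 * M / r * dist z x :=
    le_of_tendsto ((hpt z (hrU hz)).dist (hpt x (hKU hx)))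
      (Eventually.of_forall fun n => hlip n z hz)
  have h2 := hlip n z hz
  have h3 := dist_triangle4 (G u₀ z) (G u₀ x) (f n x) (f n z)
  rw [dist_comm (f n x) (f n z), dist_comm (G u₀ x) (f n x)] at h3
  linarith
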